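/- Let l, r ≥ 0 be integers with r + 1 ≤ l ≤ r + 2, let q ≥ 1 be an integer, and let λ₀, λ_∞ be as in the context. For R > 0 define λ_R(s) = λ₀(s) + R·λ_∞(s), and write x_R(θ) = Re λ_R(e^{iθ}), y_R(θ) = Im λ_R(e^{iθ}). Then there exist constants C₂ > 0, C > 0 and δ > 0, with C₂ depending only on l, r, q, such that for every R > 0 and all θ with 0 < |θ| < δ, | x_R(θ) + C₂ · y_R(θ)^{2l} + R · y_R(θ)² | ≤ C · ( |y_R(θ)|^{2l+2} + R · |y_R(θ)|^{min(2r+4, 2q+2)} ). That is, x_R = -C₂·y_R^{2l} + O(y_R^{2l+2}) + R·(-y_R² + O(y_R^{min(2r+4,2q+2)})) as θ → 0. -/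

import Mathlib

/-- Optimal finite-difference coefficients for the first derivative on the
stencil `{-l, …, r}`. -/
noncomputable def aCoef (l r : ℕ) (k : ℤ) : ℝ :=
  if k = 0 then
    -∑ ν ∈ (Finset.Icc (-(l : ℤ)) (r : ℤ)).erase 0, (1 : ℝ) / (ν : ℝ)
  else
    -((-1 : ℝ) ^ k / (k : ℝ)) *
      ((Nat.factorial l * Nat.factorial r : ℕ) : ℝ) /
      ((Nat.factorial ((l : ℤ) + k).toNat * Nat.factorial ((r : ℤ) - k).toNat : ℕ) : ℝ)

/-- The symbol `λ₀(s) = -Σ_{k=-l}^{r} a_k s^k` of the advection discretization. -/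
noncomputable def lam0 (l r : ℕ) (s : ℂ) : ℂ :=
  -∑ k ∈ Finset.Icc (-(l : ℤ)) (r : ℤ), (aCoef l r k : ℂ) * s ^ k

/-- Optimal centered finite-difference coefficients for the second derivative on
the stencil `{-q, …, q}`. -/
noncomputable def bCoef (q : ℕ) (k : ℤ) : ℝ :=
  if k = 0 then
    -∑ j ∈ Finset.Icc 1 q, 2 / (j : ℝ) ^ 2
  else
    -(2 * (-1 : ℝ) ^ k / (k : ℝ) ^ 2) *
      ((Nat.factorial q * Nat.factorial q : ℕ) : ℝ) /
      ((Nat.factorial ((q : ℤ) + k).toNat * Nat.factorial ((q : ℤ) - k).toNat : ℕ) : ℝ)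

/-- The symbol `λ_∞(s) = Σ_{k=-q}^{q} b_k s^k` of the diffusion discretization. -/
noncomputable def lamInf (q : ℕ) (s : ℂ) : ℂ :=
  ∑ k ∈ Finset.Icc (-(q : ℤ)) (q : ℤ), (bCoef q k : ℂ) * s ^ k

open Asymptotics Filter Topology
noncomputable def wC (l r : ℕ) (k : ℤ) : ℝ :=
  (-1 : ℝ) ^ k * ((Nat.factorial l * Nat.factorial r : ℕ) : ℝ) /
      ((Nat.factorial ((l : ℤ) + k).toNat * Nat.factorial ((r : ℤ) - k).toNat : ℕ) : ℝ)

noncomputable def cC (l r : ℕ) : ℝ :=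
  ((Nat.factorial l * Nat.factorial r : ℕ) : ℝ) / ((Nat.factorial (l + r) : ℕ) : ℝ)

lemma cC_pos (l r : ℕ) : 0 < cC l r := by unfold cC; positivity

lemma wC_zero (l r : ℕ) : wC l r 0 = 1 := by
  unfold wC
  have h : ((Nat.factorial l * Nat.factorial r : ℕ) : ℝ) ≠ 0 := by positivity
  simp only [add_zero, sub_zero, Int.toNat_natCast, zpow_zero, one_mul]
  exact div_self h

lemma wC_symm (l r : ℕ) (k : ℤ) : wC l r (-k) = wC r l k := by
  unfold wC
  have h : (-1 : ℝ) ^ (-k) = (-1) ^ k := by rw [zpow_neg, ← inv_zpow]; norm_num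
  rw [h]
  simp only [sub_neg_eq_add, ← sub_eq_add_neg, Nat.mul_comm]

lemma sum_Icc_reindex {M : Type*} [AddCommMonoid M] (l r : ℕ) (f : ℤ → M) :
    ∑ k ∈ Finset.Icc (-(l : ℤ)) (r : ℤ), f k
      = ∑ j ∈ Finset.range (l + r + 1), f ((j : ℤ) - l) := by
  symm
  refine Finset.sum_bij (fun j _ => (j : ℤ) - l) ?_ ?_ ?_ ?_
  · intro j hj; simp at hj ⊢; omega
  · intro a _ b _ h; simp at h; exact h
  · intro b hb
    simp at hb
    exact ⟨(b + l).toNat, by simp; omega, by simp; omega⟩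
  · intros; rfl

lemma sum_Icc_neg {M : Type*} [AddCommMonoid M] (l r : ℕ) (f : ℤ → M) :
    ∑ k ∈ Finset.Icc (-(l : ℤ)) (r : ℤ), f (-k)
      = ∑ k ∈ Finset.Icc (-(r : ℤ)) (l : ℤ), f k := by
  refine Finset.sum_bij (fun j _ => -j) ?_ ?_ ?_ ?_
  · intro j hj; simp at hj ⊢; omega
  · intro a _ b _ h; simpa using h
  · intro b hb
    simp at hb
    exact ⟨-b, by simp; omega, by simp⟩
  · intros; rfl

lemma sum_Icc_succ {M : Type*} [AddCommMonoid M] (l r : ℕ) (f : ℤ → M) :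
    ∑ k ∈ Finset.Icc (-(l : ℤ)) ((r + 1 : ℕ) : ℤ), f k
      = ∑ k ∈ Finset.Icc (-(l : ℤ)) (r : ℤ), f k + f (r + 1) := by
  rw [sum_Icc_reindex, sum_Icc_reindex, ← add_assoc, Finset.sum_range_succ]
  congr 2
  push_cast; ring

lemma sum_Icc_pred {M : Type*} [AddCommMonoid M] (l r : ℕ) (f : ℤ → M) :
    ∑ k ∈ Finset.Icc (-((l + 1 : ℕ) : ℤ)) (r : ℤ), f k
      = ∑ k ∈ Finset.Icc (-(l : ℤ)) (r : ℤ), f k + f (-(l + 1)) := by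
  rw [← sum_Icc_neg, sum_Icc_succ, sum_Icc_neg]

lemma wC_gen (l r : ℕ) (s : ℂ) (hs : s ≠ 0) :
    ∑ k ∈ Finset.Icc (-(l : ℤ)) (r : ℤ), (wC l r k : ℂ) * s ^ k
      = cC l r * (-1) ^ l * (s ^ l)⁻¹ * (1 - s) ^ (l + r) := by
  rw [sum_Icc_reindex, sub_eq_neg_add, add_pow, Finset.mul_sum]
  refine Finset.sum_congr rfl fun j hj => ?_
  have hj' : j ≤ l + r := by simp at hj; omega
  rw [Nat.choose_eq_factorial_div_factorial hj',
    Nat.cast_div (Nat.factorial_mul_factorial_dvd_factorial hj')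
      (by exact_mod_cast (Nat.mul_pos (Nat.factorial_pos _) (Nat.factorial_pos _)).ne')]
  have f1 : ((l + r).factorial : ℂ) ≠ 0 := by exact_mod_cast (Nat.factorial_pos _).ne'
  have f2 : ((j).factorial : ℂ) ≠ 0 := by exact_mod_cast (Nat.factorial_pos _).ne'
  have f3 : ((l + r - j).factorial : ℂ) ≠ 0 := by exact_mod_cast (Nat.factorial_pos _).ne'
  unfold wC cC
  have e1 : ((l : ℤ) + ((j : ℤ) - l)).toNat = j := by omega
  have e2 : ((r : ℤ) - ((j : ℤ) - l)).toNat = l + r - j := by omega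
  rw [e1, e2]
  have e3 : (-1 : ℝ) ^ ((j : ℤ) - l) = (-1) ^ l * (-1) ^ j := by
    rw [zpow_sub₀ (by norm_num)]
    simp only [zpow_natCast]
    rcases neg_one_pow_eq_or ℝ l with h | h <;> rw [h] <;> simp [div_neg]
  rw [e3, zpow_sub₀ hs, neg_pow s]
  push_cast
  simp only [zpow_natCast]
  field_simp
  ring

lemma wC_sum (l r : ℕ) (h : 0 < l + r) :
    ∑ k ∈ Finset.Icc (-(l : ℤ)) (r : ℤ), wC l r k = 0 := by
  have := wC_gen l r 1 one_ne_zero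
  simp at this
  have h2 : ¬ (l = 0 ∧ r = 0) := by omega
  simp [h2] at this
  exact_mod_cast this

lemma wC_step (l r : ℕ) (k : ℤ) (h2 : k ≤ r) :
    wC l (r + 1) k * (r + 1 - k) = wC l r k * (r + 1) := by
  unfold wC
  obtain ⟨m, hm⟩ : ∃ m : ℕ, (r : ℤ) - k = m := ⟨((r : ℤ) - k).toNat, by omega⟩
  have e1 : (((r + 1 : ℕ) : ℤ) - k).toNat = m + 1 := by omega
  have e2 : ((r : ℤ) - k).toNat = m := by omega
  have e3 : (r + 1 - k : ℝ) = m + 1 := by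
    have : (r : ℝ) - k = m := by exact_mod_cast hm
    linarith
  rw [e1, e2, e3, Nat.factorial_succ, Nat.factorial_succ]
  push_cast
  field_simp

lemma harm_step (l r : ℕ)
    (h : ∑ k ∈ Finset.Icc (-(l : ℤ)) (r : ℤ), (1 + wC l r k) / (k : ℝ) = 0) :
    ∑ k ∈ Finset.Icc (-(l : ℤ)) ((r + 1 : ℕ) : ℤ), (1 + wC l (r + 1) k) / (k : ℝ) = 0 := by
  have hs := wC_sum l (r + 1) (by omega)
  rw [sum_Icc_succ] at hs ⊢
  have key : ∀ k ∈ Finset.Icc (-(l : ℤ)) (r : ℤ), (1 + wC l (r + 1) k) / (k : ℝ)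
      = (1 + wC l r k) / (k : ℝ) + (wC l (r + 1) k - if k = 0 then 1 else 0) / (r + 1) := by
    intro k hk
    have h2 : k ≤ r := (Finset.mem_Icc.1 hk).2
    have := wC_step l r k h2
    by_cases h0 : k = 0
    · subst h0; simp [wC_zero]
    · have h0' : (k : ℝ) ≠ 0 := by exact_mod_cast h0
      have hr : (r + 1 : ℝ) ≠ 0 := by positivity
      simp only [h0, if_false]
      field_simp
      linarith
  rw [Finset.sum_congr rfl key, Finset.sum_add_distrib, h, ← Finset.sum_div,
    Finset.sum_sub_distrib]
  have h0 : ∑ k ∈ Finset.Icc (-(l : ℤ)) (r : ℤ), (if k = 0 then (1 : ℝ) else 0) = 1 := by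
    rw [Finset.sum_ite_eq']; simp
  rw [h0]
  push_cast
  rw [zero_add, ← add_div]
  have : ∑ k ∈ Finset.Icc (-(l : ℤ)) (r : ℤ), wC l (r + 1) k - 1
    + (1 + wC l (r + 1) (r + 1)) = 0 := by linarith
  rw [this, zero_div]

lemma harm_symm (l r : ℕ)
    (h : ∑ k ∈ Finset.Icc (-(l : ℤ)) (r : ℤ), (1 + wC l r k) / (k : ℝ) = 0) :
    ∑ k ∈ Finset.Icc (-(r : ℤ)) (l : ℤ), (1 + wC r l k) / (k : ℝ) = 0 := by
  rw [← sum_Icc_neg, ← neg_eq_zero, ← Finset.sum_neg_distrib, ← h]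
  refine Finset.sum_congr rfl fun k _ => ?_
  rw [wC_symm]
  push_cast
  rw [div_neg, neg_neg]

lemma harm (l r : ℕ) :
    ∑ k ∈ Finset.Icc (-(l : ℤ)) (r : ℤ), (1 + wC l r k) / (k : ℝ) = 0 := by
  have h0 : ∀ n : ℕ, ∑ k ∈ Finset.Icc (-((0 : ℕ) : ℤ)) (n : ℤ), (1 + wC 0 n k) / (k : ℝ) = 0 := by
    intro n
    induction n with
    | zero => simp
    | succ n ih => exact harm_step 0 n ih
  induction r with
  | zero => exact harm_symm _ _ (h0 l)
  | succ n ih => exact harm_step l n ih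

lemma aCoef_ne (l r : ℕ) (k : ℤ) (h : k ≠ 0) : aCoef l r k = -(wC l r k / k) := by
  unfold aCoef wC
  rw [if_neg h]
  ring

lemma aCoef_mul (l r : ℕ) (k : ℤ) :
    aCoef l r k * k = (if k = 0 then 1 else 0) - wC l r k := by
  by_cases h : k = 0
  · subst h; simp [wC_zero]
  · have h0' : (k : ℝ) ≠ 0 := by exact_mod_cast h
    rw [aCoef_ne l r k h]; simp [h, h0']

lemma aCoef_sum (l r : ℕ) : ∑ k ∈ Finset.Icc (-(l : ℤ)) (r : ℤ), aCoef l r k = 0 := by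
  have hm : (0 : ℤ) ∈ Finset.Icc (-(l : ℤ)) (r : ℤ) := by simp
  have h := harm l r
  rw [← Finset.add_sum_erase _ _ hm] at h ⊢
  have e : aCoef l r 0 = -∑ ν ∈ (Finset.Icc (-(l : ℤ)) (r : ℤ)).erase 0, (1 : ℝ) / (ν : ℝ) := by
    unfold aCoef; rw [if_pos rfl]
  rw [e, Finset.sum_congr rfl fun k hk => aCoef_ne l r k (Finset.ne_of_mem_erase hk),
    Finset.sum_neg_distrib, ← neg_add, ← Finset.sum_add_distrib]
  simp only [← add_div]
  simpa using h

lemma aCoef_zero (q : ℕ) : aCoef q q 0 = 0 := by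
  have e : aCoef q q 0 = -∑ ν ∈ (Finset.Icc (-(q : ℤ)) (q : ℤ)).erase 0, (1 : ℝ) / (ν : ℝ) := by
    unfold aCoef; rw [if_pos rfl]
  have hm : (0 : ℤ) ∈ Finset.Icc (-(q : ℤ)) (q : ℤ) := by simp
  have h2 := sum_Icc_neg q q (fun k => (1 : ℝ) / (k : ℝ))
  push_cast at h2
  simp only [div_neg, Finset.sum_neg_distrib] at h2
  rw [← Finset.add_sum_erase _ _ hm] at h2
  simp at h2
  rw [e]; simp; linarith

lemma wC_step2 (q : ℕ) (k : ℤ) (h1 : -(q : ℤ) ≤ k) (h2 : k ≤ q) :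
    wC (q + 1) (q + 1) k * ((q + 1) ^ 2 - k ^ 2) = wC q q k * (q + 1) ^ 2 := by
  have a := wC_step (q + 1) q k h2
  have b := wC_step q q (-k) (by omega)
  rw [wC_symm, wC_symm] at b
  push_cast at b
  linear_combination (q + 1 + k : ℝ) * a + (q + 1 : ℝ) * b

lemma sq_sum (q : ℕ) : ∑ k ∈ Finset.Icc (-(q : ℤ)) (q : ℤ), wC q q k / (k : ℝ) ^ 2
    = -∑ j ∈ Finset.Icc 1 q, 1 / (j : ℝ) ^ 2 := by
  induction q with
  | zero => simp
  | succ q ih =>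
    have hs := wC_sum (q + 1) (q + 1) (by omega)
    rw [sum_Icc_succ, sum_Icc_pred] at hs ⊢
    have key : ∀ k ∈ Finset.Icc (-(q : ℤ)) (q : ℤ), wC (q + 1) (q + 1) k / (k : ℝ) ^ 2
        = wC q q k / (k : ℝ) ^ 2
          + (wC (q + 1) (q + 1) k - if k = 0 then 1 else 0) / (q + 1) ^ 2 := by
      intro k hk
      have h2 := (Finset.mem_Icc.1 hk)
      have := wC_step2 q k h2.1 h2.2
      by_cases h0 : k = 0
      · subst h0; simp [wC_zero]
      · have h0' : (k : ℝ) ≠ 0 := by exact_mod_cast h0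
        have hr : (q + 1 : ℝ) ≠ 0 := by positivity
        simp only [h0, if_false]
        field_simp
        linarith
    have h0 : ∑ k ∈ Finset.Icc (-(q : ℤ)) (q : ℤ), (if k = 0 then (1 : ℝ) else 0) = 1 := by
      rw [Finset.sum_ite_eq']; simp
    rw [Finset.sum_congr rfl key, Finset.sum_add_distrib, ih, ← Finset.sum_div,
      Finset.sum_sub_distrib, h0, Finset.sum_Icc_succ_top (by omega)]
    push_cast
    have hr : (q + 1 : ℝ) ≠ 0 := by positivity
    have e : (-(q + 1 : ℝ)) ^ 2 = (q + 1) ^ 2 := by ring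
    rw [e]
    field_simp
    linear_combination hs

lemma bCoef_ne (q : ℕ) (k : ℤ) (h : k ≠ 0) : bCoef q k = -2 * (wC q q k / k ^ 2) := by
  unfold bCoef wC
  rw [if_neg h]
  ring

lemma bCoef_mul (q : ℕ) (k : ℤ) : bCoef q k * k = 2 * aCoef q q k := by
  by_cases h : k = 0
  · subst h; simp [aCoef_zero]
  · have h0' : (k : ℝ) ≠ 0 := by exact_mod_cast h
    rw [bCoef_ne q k h, aCoef_ne q q k h]; field_simp

lemma bCoef_sum (q : ℕ) : ∑ k ∈ Finset.Icc (-(q : ℤ)) (q : ℤ), bCoef q k = 0 := by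
  have hm : (0 : ℤ) ∈ Finset.Icc (-(q : ℤ)) (q : ℤ) := by simp
  have h := sq_sum q
  rw [← Finset.add_sum_erase _ _ hm] at h ⊢
  have e : bCoef q 0 = -∑ j ∈ Finset.Icc 1 q, 2 / (j : ℝ) ^ 2 := by
    unfold bCoef; rw [if_pos rfl]
  rw [e, Finset.sum_congr rfl fun k hk => bCoef_ne q k (Finset.ne_of_mem_erase hk),
    ← Finset.mul_sum]
  have e2 : ∑ j ∈ Finset.Icc 1 q, 2 / (j : ℝ) ^ 2 = 2 * ∑ j ∈ Finset.Icc 1 q, 1 / (j : ℝ) ^ 2 := by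
    rw [Finset.mul_sum]; refine Finset.sum_congr rfl fun k _ => ?_
    ring
  rw [e2]
  simp only [Int.cast_zero, ne_eq, OfNat.ofNat_ne_zero, not_false_eq_true, zero_pow, div_zero, zero_add] at h
  linarith

lemma hasDerivAt_expk (k : ℤ) (θ : ℝ) :
    HasDerivAt (fun t : ℝ => Complex.exp (t * Complex.I) ^ k)
      (k * Complex.I * Complex.exp (θ * Complex.I) ^ k) θ := by
  have h : HasDerivAt (fun z : ℂ => Complex.exp (k * (z * Complex.I)))
      (Complex.exp (k * (θ * Complex.I)) * (k * (1 * Complex.I))) (θ : ℂ) :=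
    (((hasDerivAt_id (θ : ℂ)).mul_const Complex.I).const_mul (k : ℂ)).cexp
  have h2 := h.comp_ofReal
  simp only [Complex.exp_int_mul] at h2
  refine HasDerivAt.congr_deriv (h2) ?_
  symm
  ring

lemma hasDerivAt_trig (S : Finset ℤ) (f : ℤ → ℝ) (θ : ℝ) :
    HasDerivAt (fun t : ℝ => ∑ k ∈ S, (f k : ℂ) * Complex.exp (t * Complex.I) ^ k)
      (Complex.I * ∑ k ∈ S, ((f k * k : ℝ) : ℂ) * Complex.exp (θ * Complex.I) ^ k) θ := by
  rw [Finset.mul_sum]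
  refine HasDerivAt.fun_sum fun k _ => ?_
  refine HasDerivAt.congr_deriv ((hasDerivAt_expk k θ).const_mul (f k : ℂ)) ?_
  symm
  push_cast; ring

noncomputable def F0 (l r : ℕ) (t : ℝ) : ℂ := lam0 l r (Complex.exp (t * Complex.I))
noncomputable def Fi (q : ℕ) (t : ℝ) : ℂ := lamInf q (Complex.exp (t * Complex.I))

lemma F0_zero (l r : ℕ) : F0 l r 0 = 0 := by
  have := aCoef_sum l r
  simp only [F0, lam0, Complex.ofReal_zero, zero_mul, Complex.exp_zero, one_zpow, mul_one,
    neg_eq_zero]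
  exact_mod_cast this

lemma Fi_zero (q : ℕ) : Fi q 0 = 0 := by
  have := bCoef_sum q
  simp only [Fi, lamInf, Complex.ofReal_zero, zero_mul, Complex.exp_zero, one_zpow, mul_one]
  exact_mod_cast this

lemma Fi_deriv (q : ℕ) (θ : ℝ) : HasDerivAt (Fi q) (-2 * Complex.I * F0 q q θ) θ := by
  have h := hasDerivAt_trig (Finset.Icc (-(q : ℤ)) (q : ℤ)) (bCoef q) θ
  unfold Fi lamInf
  refine HasDerivAt.congr_deriv (h) ?_
  symm
  simp only [F0, lam0, bCoef_mul]
  rw [mul_neg, ← neg_mul, Finset.mul_sum, Finset.mul_sum]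
  refine Finset.sum_congr rfl fun k _ => ?_
  push_cast; ring

lemma F0_deriv (l r : ℕ) (θ : ℝ) : HasDerivAt (F0 l r)
    (-Complex.I + Complex.I * (cC l r * (-1) ^ l * (Complex.exp (θ * Complex.I) ^ l)⁻¹ *
      (1 - Complex.exp (θ * Complex.I)) ^ (l + r))) θ := by
  have h := (hasDerivAt_trig (Finset.Icc (-(l : ℤ)) (r : ℤ)) (aCoef l r) θ).neg
  unfold F0 lam0
  refine HasDerivAt.congr_deriv (h) ?_
  symm
  rw [← wC_gen l r _ (Complex.exp_ne_zero _)]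
  have h0 : ∑ k ∈ Finset.Icc (-(l : ℤ)) (r : ℤ),
      (((if k = 0 then 1 else 0 : ℝ)) : ℂ) * Complex.exp (θ * Complex.I) ^ k = 1 := by
    rw [Finset.sum_eq_single 0]
    · simp
    · intro b _ hb; simp [hb]
    · simp
  simp only [aCoef_mul, Complex.ofReal_sub, sub_mul, Finset.sum_sub_distrib, h0]
  ring

lemma exp_sq (θ : ℝ) : -(1 - Complex.exp (θ * Complex.I)) ^ 2 * (Complex.exp (θ * Complex.I))⁻¹
    = ((2 - 2 * Real.cos θ : ℝ) : ℂ) := by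
  have hne := Complex.exp_ne_zero (θ * Complex.I)
  push_cast
  rw [Complex.cos, neg_mul, neg_mul, Complex.exp_neg]
  field_simp
  ring

lemma exp_inv (θ : ℝ) : (Complex.exp (θ * Complex.I))⁻¹
    = (Real.cos θ : ℂ) - Real.sin θ * Complex.I := by
  rw [← Complex.exp_neg, ← neg_mul, Complex.exp_mul_I]
  push_cast
  simp; ring

lemma F0_deriv_qq (q : ℕ) (θ : ℝ) : HasDerivAt (F0 q q)
    (((-1 + cC q q * (2 - 2 * Real.cos θ) ^ q : ℝ) : ℂ) * Complex.I) θ := by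
  refine HasDerivAt.congr_deriv (F0_deriv q q θ) ?_
  symm
  have := congrArg (· ^ q) (exp_sq θ)
  simp only [mul_pow, neg_pow ((1 - Complex.exp (θ * Complex.I)) ^ 2), inv_pow, ← pow_mul] at this
  rw [← two_mul]
  push_cast at this ⊢
  rw [← this]
  ring

lemma F0_deriv_1 (r : ℕ) (θ : ℝ) : HasDerivAt (F0 (r + 1) r)
    (((-(cC (r + 1) r * (2 - 2 * Real.cos θ) ^ r * Real.sin θ) : ℝ) : ℂ)
    + ((-1 + cC (r + 1) r * (2 - 2 * Real.cos θ) ^ r * (1 - Real.cos θ) : ℝ) : ℂ) * Complex.I) θ := by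
  refine HasDerivAt.congr_deriv (F0_deriv (r + 1) r θ) ?_
  symm
  have h := congrArg (· ^ r) (exp_sq θ)
  simp only [mul_pow, neg_pow ((1 - Complex.exp (θ * Complex.I)) ^ 2), inv_pow, ← pow_mul] at h
  have h2 := exp_inv θ
  have hne := Complex.exp_ne_zero (θ * Complex.I)
  have h3 : (-1) ^ (r + 1) * (Complex.exp (θ * Complex.I) ^ (r + 1))⁻¹ *
      (1 - Complex.exp (θ * Complex.I)) ^ (r + 1 + r)
      = ((2 - 2 * Real.cos θ : ℝ) : ℂ) ^ r * (1 - (Complex.exp (θ * Complex.I))⁻¹) := by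
    rw [← h]
    field_simp
    ring
  rw [mul_assoc (cC (r + 1) r : ℂ), mul_assoc (cC (r + 1) r : ℂ), h3, h2]
  push_cast
  linear_combination (cC (r + 1) r : ℂ) * (2 - 2 * Complex.cos θ) ^ r * (-Complex.sin θ) * Complex.I_sq

lemma F0_deriv_2 (r : ℕ) (θ : ℝ) : HasDerivAt (F0 (r + 2) r)
    (((-(cC (r + 2) r * (2 - 2 * Real.cos θ) ^ (r + 1) * Real.sin θ) : ℝ) : ℂ)
    + ((-1 - cC (r + 2) r * (2 - 2 * Real.cos θ) ^ (r + 1) * Real.cos θ : ℝ) : ℂ) * Complex.I) θ := by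
  refine HasDerivAt.congr_deriv (F0_deriv (r + 2) r θ) ?_
  symm
  have h := congrArg (· ^ (r + 1)) (exp_sq θ)
  simp only [mul_pow, neg_pow ((1 - Complex.exp (θ * Complex.I)) ^ 2), inv_pow, ← pow_mul] at h
  have h2 := exp_inv θ
  have hne := Complex.exp_ne_zero (θ * Complex.I)
  have h3 : (-1) ^ (r + 2) * (Complex.exp (θ * Complex.I) ^ (r + 2))⁻¹ *
      (1 - Complex.exp (θ * Complex.I)) ^ (r + 2 + r)
      = ((2 - 2 * Real.cos θ : ℝ) : ℂ) ^ (r + 1) * (- (Complex.exp (θ * Complex.I))⁻¹) := by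
    rw [← h]
    field_simp
    ring
  rw [mul_assoc (cC (r + 2) r : ℂ), mul_assoc (cC (r + 2) r : ℂ), h3, h2]
  push_cast
  linear_combination (cC (r + 2) r : ℂ) * (2 - 2 * Complex.cos θ) ^ (r + 1) * (-Complex.sin θ) * Complex.I_sq

lemma HasDerivAt.re_aux {f : ℝ → ℂ} {f' : ℂ} {x : ℝ} (h : HasDerivAt f f' x) :
    HasDerivAt (fun t => (f t).re) f'.re x :=
  (Complex.reCLM.hasFDerivAt.comp_hasDerivAt x h)

lemma HasDerivAt.im_aux {f : ℝ → ℂ} {f' : ℂ} {x : ℝ} (h : HasDerivAt f f' x) :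
    HasDerivAt (fun t => (f t).im) f'.im x :=
  (Complex.imCLM.hasFDerivAt.comp_hasDerivAt x h)

lemma const_aux {f : ℝ → ℝ} (h : ∀ x, HasDerivAt f 0 x) (h0 : f 0 = 0) (x : ℝ) : f x = 0 := by
  rw [← h0]
  exact is_const_of_deriv_eq_zero (fun y => (h y).differentiableAt) (fun y => (h y).deriv) x 0

lemma F0qq_re (q : ℕ) (θ : ℝ) : (F0 q q θ).re = 0 := by
  refine const_aux (f := fun t => (F0 q q t).re) (fun x => ?_) (by simp [F0_zero]) θ
  refine HasDerivAt.congr_deriv ((F0_deriv_qq q x).re_aux) ?_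
  symm
  rw [Complex.re_ofReal_mul]; simp

lemma Fi_im (q : ℕ) (θ : ℝ) : (Fi q θ).im = 0 := by
  refine const_aux (f := fun t => (Fi q t).im) (fun x => ?_) (by simp [Fi_zero]) θ
  refine HasDerivAt.congr_deriv ((Fi_deriv q x).im_aux) ?_
  symm
  simp [F0qq_re]

lemma u_pow_deriv (c : ℝ) (n : ℕ) (θ : ℝ) :
    HasDerivAt (fun t => c / (2 * (n + 1)) * (2 - 2 * Real.cos t) ^ (n + 1))
      (c * (2 - 2 * Real.cos θ) ^ n * Real.sin θ) θ := by
  have h := ((((Real.hasDerivAt_cos θ).const_mul 2).const_sub 2).pow (n + 1)).const_mul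
    (c / (2 * (n + 1)))
  refine HasDerivAt.congr_deriv (h) ?_
  symm
  have : (n + 1 : ℝ) ≠ 0 := by positivity
  simp
  field_simp

lemma F0_re (l r : ℕ) (h1 : r + 1 ≤ l) (h2 : l ≤ r + 2) (θ : ℝ) :
    (F0 l r θ).re = -(cC l r / (2 * l) * (2 - 2 * Real.cos θ) ^ l) := by
  have key : ∀ n : ℕ, l = n + 1 → (∀ x, HasDerivAt (fun t => (F0 l r t).re)
      (-(cC l r * (2 - 2 * Real.cos x) ^ n * Real.sin x)) x) →
      (F0 l r θ).re = -(cC l r / (2 * l) * (2 - 2 * Real.cos θ) ^ l) := by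
    intro n hn h
    have := const_aux (f := fun t => (F0 l r t).re
      + cC l r / (2 * (n + 1)) * (2 - 2 * Real.cos t) ^ (n + 1))
      (fun x => ((h x).add (u_pow_deriv (cC l r) n x)).congr_deriv (by ring)) (by simp [F0_zero]) θ
    have hc : (l : ℝ) = n + 1 := by rw [hn]; push_cast; ring
    have hp : (2 - 2 * Real.cos θ) ^ l = (2 - 2 * Real.cos θ) ^ (n + 1) := by rw [hn]
    rw [hc, hp]; linarith
  obtain rfl | rfl : l = r + 1 ∨ l = r + 2 := by omega
  · refine key r rfl fun x => ?_
    refine HasDerivAt.congr_deriv ((F0_deriv_1 r x).re_aux) ?_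
    symm
    rw [Complex.add_re, Complex.re_ofReal_mul, Complex.ofReal_re]; simp
  · refine key (r + 1) rfl fun x => ?_
    refine HasDerivAt.congr_deriv ((F0_deriv_2 r x).re_aux) ?_
    symm
    rw [Complex.add_re, Complex.re_ofReal_mul, Complex.ofReal_re]; simp

lemma bigO_int {G g : ℝ → ℝ} {n : ℕ} (h : ∀ x, HasDerivAt G (g x) x) (h0 : G 0 = 0)
    (hg : g =O[𝓝 0] fun x => x ^ n) : G =O[𝓝 0] fun x => x ^ (n + 1) := by
  obtain ⟨C, hC⟩ := hg.bound
  obtain ⟨ε, hε, hb⟩ := Metric.eventually_nhds_iff_ball.1 hC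
  refine IsBigO.of_bound C ?_
  filter_upwards [Metric.ball_mem_nhds (0 : ℝ) hε] with x hx
  have hx' : |x| < ε := by simpa using hx
  have hC0 : ∀ y : ℝ, |y| ≤ |x| → ‖g y‖ ≤ C * |x| ^ n := by
    intro y hy
    have a := hb y (by simpa using lt_of_le_of_lt hy hx')
    by_cases hy0 : C < 0
    · have : ‖g x‖ ≤ C * ‖x ^ n‖ := hb x hx
      have h3 := norm_nonneg (g y)
      have h4 := norm_nonneg (g x)
      have h5 : 0 ≤ ‖y ^ n‖ := norm_nonneg _
      have h6 : 0 ≤ ‖x ^ n‖ := norm_nonneg _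
      have h7 : ‖x ^ n‖ = |x| ^ n := by simp
      nlinarith
    · refine a.trans ?_
      rw [norm_pow, Real.norm_eq_abs]
      have : 0 ≤ C := not_lt.1 hy0
      gcongr
  have := (convex_closedBall (0 : ℝ) |x|).norm_image_sub_le_of_norm_hasDerivWithin_le
    (f := G) (f' := g) (C := C * |x| ^ n) (x := 0) (y := x)
    (fun y _ => (h y).hasDerivWithinAt) (fun y hy => hC0 y (by simpa using hy))
    (by simp) (by simp)
  simpa [h0, pow_succ, mul_assoc] using this

lemma u_bigO : (fun x : ℝ => 2 - 2 * Real.cos x) =O[𝓝 0] fun x => x ^ 2 := by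
  refine bigO_int (g := fun x => 2 * Real.sin x) (n := 1) (fun x => ?_) (by simp) ?_
  · refine HasDerivAt.congr_deriv (((Real.hasDerivAt_cos x).const_mul 2).const_sub 2) ?_
    symm
    ring
  · refine IsBigO.const_mul_left ?_ 2
    refine IsBigO.of_bound 1 (Eventually.of_forall fun x => ?_)
    simpa using Real.abs_sin_le_abs

lemma u_bigO2 : (fun x : ℝ => 2 - 2 * Real.cos x - x ^ 2) =O[𝓝 0] fun x => x ^ 4 := by
  refine bigO_int (g := fun x => 2 * Real.sin x - 2 * x) (n := 3) (fun x => ?_) (by simp) ?_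
  · refine HasDerivAt.congr_deriv ((((Real.hasDerivAt_cos x).const_mul 2).const_sub 2).sub ((hasDerivAt_pow 2 x))) ?_
    symm
    simp
  · refine bigO_int (g := fun x => 2 * Real.cos x - 2) (n := 2) (fun x => ?_) (by simp) ?_
    · refine HasDerivAt.congr_deriv (((Real.hasDerivAt_sin x).const_mul 2).sub ((hasDerivAt_id x).const_mul 2)) ?_
      symm
      simp
    · simpa using u_bigO.neg_left

lemma u_pow_bigO (n : ℕ) : (fun x : ℝ => (2 - 2 * Real.cos x) ^ n) =O[𝓝 0] fun x => x ^ (2 * n) := by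
  simpa [pow_mul] using u_bigO.pow n

lemma Fi_bigO (q : ℕ) : (fun t => (Fi q t).re + t ^ 2) =O[𝓝 0] fun x => x ^ (2 * q + 2) := by
  refine bigO_int (g := fun t => 2 * ((F0 q q t).im + t)) (n := 2 * q + 1) (fun x => ?_)
    (by simp [Fi_zero]) (IsBigO.const_mul_left ?_ 2)
  · refine HasDerivAt.congr_deriv (((Fi_deriv q x).re_aux).add (hasDerivAt_pow 2 x)) ?_
    symm
    simp; ring
  · refine bigO_int (g := fun t => cC q q * (2 - 2 * Real.cos t) ^ q) (fun x => ?_)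
      (by simp [F0_zero]) ((u_pow_bigO q).const_mul_left _)
    refine HasDerivAt.congr_deriv (((F0_deriv_qq q x).im_aux).add (hasDerivAt_id x)) ?_
    symm
    rw [Complex.im_ofReal_mul]; simp

lemma F0_im_bigO (l r : ℕ) (h1 : r + 1 ≤ l) (h2 : l ≤ r + 2) :
    (fun t => (F0 l r t).im + t) =O[𝓝 0] fun x => x ^ (2 * r + 3) := by
  obtain rfl | rfl : l = r + 1 ∨ l = r + 2 := by omega
  · refine bigO_int (g := fun t => cC (r + 1) r / 2 * (2 - 2 * Real.cos t) ^ (r + 1))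
      (n := 2 * r + 2) (fun x => ?_)
      (by simp [F0_zero]) ((u_pow_bigO (r + 1)).const_mul_left _)
    refine HasDerivAt.congr_deriv (((F0_deriv_1 r x).im_aux).add (hasDerivAt_id x)) ?_
    symm
    rw [Complex.add_im, Complex.im_ofReal_mul, Complex.ofReal_im]; simp; ring
  · refine bigO_int (g := fun t => -cC (r + 2) r * (2 - 2 * Real.cos t) ^ (r + 1) * Real.cos t)
      (n := 2 * r + 2) (fun x => ?_)
      (by simp [F0_zero]) ?_
    · refine HasDerivAt.congr_deriv (((F0_deriv_2 r x).im_aux).add (hasDerivAt_id x)) ?_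
      symm
      rw [Complex.add_im, Complex.im_ofReal_mul, Complex.ofReal_im]; simp; ring
    · have hc : Real.cos =O[𝓝 0] fun _ => (1 : ℝ) :=
        IsBigO.of_bound 1 (Eventually.of_forall fun x => by simpa using Real.abs_cos_le_one x)
      exact (((u_pow_bigO (r + 1)).const_mul_left (-cC (r + 2) r)).mul hc).congr_right fun x => by ring

lemma pow_sub_bigO {A B : ℝ → ℝ} (hA : A =O[𝓝 0] fun x => x ^ 2) (hB : B =O[𝓝 0] fun x => x ^ 2)
    (h : (fun x => A x - B x) =O[𝓝 0] fun x => x ^ 4) (n : ℕ) :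
    (fun x => A x ^ n - B x ^ n) =O[𝓝 0] fun x => x ^ (2 * n + 2) := by
  induction n with
  | zero => simpa using isBigO_zero _ _
  | succ n ih =>
    have e : (fun x => A x ^ (n + 1) - B x ^ (n + 1))
      = fun x => A x * (A x ^ n - B x ^ n) + (A x - B x) * B x ^ n := by ext x; ring
    rw [e]
    refine IsBigO.add ?_ ?_
    · refine (hA.mul ih).congr_right fun x => by ring
    · refine (h.mul (hB.pow n)).congr_right fun x => by ring

lemma pow_mono_bigO {m n : ℕ} (h : m ≤ n) : (fun x : ℝ => x ^ n) =O[𝓝 0] fun x => x ^ m := by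
  obtain ⟨k, rfl⟩ := Nat.exists_eq_add_of_le h
  have : (fun x : ℝ => x ^ k) =O[𝓝 0] fun _ => (1 : ℝ) :=
    (continuous_pow k).continuousAt.tendsto.isBigO_one ℝ
  simpa [pow_add] using (isBigO_refl (fun x : ℝ => x ^ m) (𝓝 0)).mul this

/-- Asymptotics of the advection-diffusion symbol `λ_R = λ₀ + R·λ_∞` near the
origin: `x_R = -C₂·y_R^{2l} + O(y_R^{2l+2}) + R·(-y_R² + O(y_R^{min(2r+4,2q+2)}))`
as `θ → 0`, uniformly in `R > 0`. -/
theorem lamR_asymptotics (l r : ℕ) (h1 : r + 1 ≤ l) (h2 : l ≤ r + 2)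
    (q : ℕ) (hq : 1 ≤ q) :
    ∃ C₂ > (0 : ℝ), ∃ C > (0 : ℝ), ∃ δ > (0 : ℝ),
      ∀ R : ℝ, 0 < R → ∀ θ : ℝ, 0 < |θ| → |θ| < δ →
        |(lam0 l r (Complex.exp (θ * Complex.I)) +
              (R : ℂ) * lamInf q (Complex.exp (θ * Complex.I))).re +
            C₂ * (lam0 l r (Complex.exp (θ * Complex.I)) +
              (R : ℂ) * lamInf q (Complex.exp (θ * Complex.I))).im ^ (2 * l) +
            R * (lam0 l r (Complex.exp (θ * Complex.I)) +
              (R : ℂ) * lamInf q (Complex.exp (θ * Complex.I))).im ^ 2| ≤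
          C * (|(lam0 l r (Complex.exp (θ * Complex.I)) +
                (R : ℂ) * lamInf q (Complex.exp (θ * Complex.I))).im| ^ (2 * l + 2) +
              R * |(lam0 l r (Complex.exp (θ * Complex.I)) +
                (R : ℂ) * lamInf q (Complex.exp (θ * Complex.I))).im| ^
                  (min (2 * r + 4) (2 * q + 2))) := by
  have hl : (0 : ℝ) < l := by exact_mod_cast (by omega : 0 < l)
  set y : ℝ → ℝ := fun t => (F0 l r t).im with hy
  have hyθ := F0_im_bigO l r h1 h2
  have hid : (fun x : ℝ => x) =O[𝓝 0] fun x => x := isBigO_refl _ _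
  have hy3 : (fun t => y t + t) =O[𝓝 0] fun x => x ^ 3 := hyθ.trans (pow_mono_bigO (by omega))
  have hy1' : (fun t => y t + t) =O[𝓝 0] fun x => x := by
    simpa using hy3.trans (pow_mono_bigO (m := 1) (by omega))
  have hsub : (fun t => y t - t) =O[𝓝 0] fun x => x := by
    have := hy1'.sub (hid.const_mul_left 2)
    refine this.congr_left fun x => by ring
  have hy1 : y =O[𝓝 0] fun x => x := by
    have := hy1'.sub hid
    refine this.congr_left fun x => by ring
  -- the reverse comparison
  have hθy : (fun x : ℝ => x) =O[𝓝 0] y := by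
    have ho : (fun t => y t + t) =o[𝓝 0] fun x => x := by
      refine hy3.trans_isLittleO ?_
      simpa using isLittleO_pow_pow (𝕜 := ℝ) (by norm_num : 1 < 3)
    have hb := ho.def (c := 1 / 2) (by norm_num)
    refine IsBigO.of_bound 2 ?_
    filter_upwards [hb] with x hx
    have := norm_sub_le (y x + x) (y x)
    rw [add_sub_cancel_left] at this
    linarith
  have hysq : (fun t => y t ^ 2 - t ^ 2) =O[𝓝 0] fun x => x ^ (2 * r + 4) := by
    refine ((hyθ.mul hsub).congr_left fun x => ?_).congr_right fun x => ?_
    · ring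
    · ring
  have hA : (fun t => (F0 l r t).re + cC l r / (2 * l) * y t ^ (2 * l))
      =O[𝓝 0] fun t => y t ^ (2 * l + 2) := by
    have hd : (fun t => y t ^ 2 - (2 - 2 * Real.cos t)) =O[𝓝 0] fun x => x ^ 4 := by
      refine ((hysq.trans (pow_mono_bigO (by omega))).sub u_bigO2).congr_left fun x => by ring
    have h := ((pow_sub_bigO (hy1.pow 2) u_bigO hd l).const_mul_left (cC l r / (2 * l))).trans
      (hθy.pow (2 * l + 2))
    refine h.congr_left fun x => ?_
    rw [F0_re l r h1 h2, pow_mul]; ring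
  have hB : (fun t => (Fi q t).re + y t ^ 2)
      =O[𝓝 0] fun t => y t ^ (min (2 * r + 4) (2 * q + 2)) := by
    have h := (((Fi_bigO q).trans (pow_mono_bigO (min_le_right (2 * r + 4) (2 * q + 2)))).add
      (hysq.trans (pow_mono_bigO (min_le_left (2 * r + 4) (2 * q + 2))))).trans
      (hθy.pow (min (2 * r + 4) (2 * q + 2)))
    exact h.congr_left fun x => by ring
  obtain ⟨C1, hC1, hb1⟩ := hA.exists_pos
  obtain ⟨C3, hC3, hb2⟩ := hB.exists_pos
  obtain ⟨δ, hδ, hb⟩ := Metric.eventually_nhds_iff_ball.1 (hb1.bound.and hb2.bound)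
  refine ⟨cC l r / (2 * l), div_pos (cC_pos l r) (by positivity), C1 + C3, by positivity, δ, hδ, ?_⟩
  intro R hR θ _ hθ
  obtain ⟨g1, g2⟩ := hb θ (by simpa using hθ)
  have him : (lam0 l r (Complex.exp (θ * Complex.I)) +
              (R : ℂ) * lamInf q (Complex.exp (θ * Complex.I))).im = y θ := by
    have := Fi_im q θ
    unfold Fi at this
    rw [Complex.add_im, Complex.im_ofReal_mul, this]; simp [hy, F0]
  have hre : (lam0 l r (Complex.exp (θ * Complex.I)) +
              (R : ℂ) * lamInf q (Complex.exp (θ * Complex.I))).re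
              = (F0 l r θ).re + R * (Fi q θ).re := by
    rw [Complex.add_re, Complex.re_ofReal_mul]; rfl
  rw [him, hre]
  rw [norm_pow, Real.norm_eq_abs, Real.norm_eq_abs] at g1 g2
  have e : (F0 l r θ).re + R * (Fi q θ).re + cC l r / (2 * l) * y θ ^ (2 * l) + R * y θ ^ 2
    = ((F0 l r θ).re + cC l r / (2 * l) * y θ ^ (2 * l)) + R * ((Fi q θ).re + y θ ^ 2) := by ring
  rw [e]
  refine (abs_add_le _ _).trans ?_
  rw [abs_mul, abs_of_pos hR]
  have p1 : 0 ≤ |y θ| ^ (2 * l + 2) := by positivity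
  have p2 : 0 ≤ R * |y θ| ^ (min (2 * r + 4) (2 * q + 2)) := by positivity
  have g3 := mul_le_mul_of_nonneg_left g2 hR.le
  nlinarith [mul_nonneg hC3.le p1, mul_nonneg hC1.le p2]
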